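/- Suppose (A,W) ∈ T(r,C₀). Then there exists C₂ > 1 such that for all t ∈ (0,1) and all x, y ∈ ℝ^d with |y − x| ≤ t, one has Φ(y,t) ≤ C₂ Φ(x,t) + C₂ t^{r+1}. -/

import Mathlib

open MeasureTheory Real Filter

noncomputable section

/-- `ℝ^d` with the Euclidean structure. -/
abbrev Rd (d : ℕ) := EuclideanSpace ℝ (Fin d)

/-- Partial derivative `∂_{x_j}` of a complex-valued function. -/
def pdC {d : ℕ} (j : Fin d) (f : Rd d → ℂ) : Rd d → ℂ :=
  fun x => fderiv ℝ f x (EuclideanSpace.single j (1:ℝ))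

/-- Partial derivative `∂_{x_j}` of a real-valued function. -/
def pdR {d : ℕ} (j : Fin d) (f : Rd d → ℝ) : Rd d → ℝ :=
  fun x => fderiv ℝ f x (EuclideanSpace.single j (1:ℝ))

/-- Iterated partial derivative in the `j`-th direction. -/
def pdIter {d : ℕ} (j : Fin d) : ℕ → (Rd d → ℝ) → (Rd d → ℝ)
  | 0, f => f
  | n+1, f => pdR j (pdIter j n f)

/-- Multi-index partial derivative `∂^α`. -/
def pdMulti {d : ℕ} (α : Fin d → ℕ) (f : Rd d → ℝ) : Rd d → ℝ :=
  (List.finRange d).foldr (fun j g => pdIter j (α j) g) f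

/-- The finite set of multi-indices `α` with `|α| = q`. -/
def mIdx (d q : ℕ) : Finset (Fin d → ℕ) := Finset.Nat.antidiagonalTuple d q

/-- The magnetic field `B_{jk} = ∂_j A_k - ∂_k A_j`. -/
def magB {d : ℕ} (A : Fin d → Rd d → ℝ) (j k : Fin d) : Rd d → ℝ :=
  fun x => pdR j (A k) x - pdR k (A j) x

/-- The quantity `m̌_q(x)`. -/
def mq {d p : ℕ} (A : Fin d → Rd d → ℝ) (U : Fin p → Rd d → ℝ) (V : Rd d → ℝ) :
    ℕ → Rd d → ℝ
  | 0, x => ∑ ℓ, |U ℓ x|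
  | q+1, x =>
      (∑ ℓ, ∑ α ∈ mIdx d (q+1), |pdMulti α (U ℓ) x|)
      + (∑ jk ∈ Finset.univ.filter (fun jk : Fin d × Fin d => jk.1 < jk.2),
          ∑ α ∈ mIdx d q, |pdMulti α (magB A jk.1 jk.2) x|)
      + ∑ α ∈ mIdx d q, |pdMulti α V x|

/-- The quantity `m̌ʳ(x) = 1 + ∑_{q=0}^r m̌_q(x)`. -/
def mr {d p : ℕ} (A : Fin d → Rd d → ℝ) (U : Fin p → Rd d → ℝ) (V : Rd d → ℝ)
    (r : ℕ) (x : Rd d) : ℝ :=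
  1 + ∑ q ∈ Finset.range (r+1), mq A U V q x

/-- The magnetic derivative `X_j u = (D_{x_j} - A_j) u`, `D_{x_j} = -i ∂_{x_j}`. -/
def Xop {d : ℕ} (A : Fin d → Rd d → ℝ) (j : Fin d) (u : Rd d → ℂ) : Rd d → ℂ :=
  fun x => -Complex.I * pdC j u x - (A j x : ℂ) * u x

/-- The potential `W = ∑_ℓ U_ℓ² + iV`. -/
def Wfun {d p : ℕ} (U : Fin p → Rd d → ℝ) (V : Rd d → ℝ) (x : Rd d) : ℂ :=
  ((∑ ℓ, (U ℓ x)^2 : ℝ) : ℂ) + (V x : ℝ) * Complex.I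

/-- The operator `P_{A,W} u = ∑_j X_j² u + W u` with `W = ∑_ℓ U_ℓ² + iV`. -/
def Pop {d p : ℕ} (A : Fin d → Rd d → ℝ) (U : Fin p → Rd d → ℝ) (V : Rd d → ℝ)
    (u : Rd d → ℂ) : Rd d → ℂ :=
  fun x => (∑ j, Xop A j (Xop A j u) x) + Wfun U V x * u x

/-- The function `Φ(x,t)`. -/
def Phi {d p : ℕ} (A : Fin d → Rd d → ℝ) (U : Fin p → Rd d → ℝ) (V : Rd d → ℝ)
    (r : ℕ) (x : Rd d) (t : ℝ) : ℝ :=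
  (∑ ℓ, ∑ q ∈ Finset.range (r+1), t^(q+1) * ∑ α ∈ mIdx d q, |pdMulti α (U ℓ) x|)
  + (∑ jk ∈ Finset.univ.filter (fun jk : Fin d × Fin d => jk.1 < jk.2),
      ∑ q ∈ Finset.range r, t^(q+2) * ∑ α ∈ mIdx d q, |pdMulti α (magB A jk.1 jk.2) x|)
  + ∑ q ∈ Finset.range r, t^(q+2) * ∑ α ∈ mIdx d q, |pdMulti α V x|

/-- `R(x,μ) = sup { t ∈ [0,1] : Φ(x,t) ≤ μ }`. -/
def Rfun {d p : ℕ} (A : Fin d → Rd d → ℝ) (U : Fin p → Rd d → ℝ) (V : Rd d → ℝ)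
    (r : ℕ) (x : Rd d) (μ : ℝ) : ℝ :=
  sSup {t : ℝ | t ∈ Set.Icc (0:ℝ) 1 ∧ Phi A U V r x t ≤ μ}


lemma pdR_smooth {d : ℕ} (j : Fin d) {f : Rd d → ℝ} (hf : ContDiff ℝ (⊤ : ℕ∞) f) :
    ContDiff ℝ (⊤ : ℕ∞) (pdR j f) := by
  unfold pdR
  have h : ContDiff ℝ (⊤ : ℕ∞) (fderiv ℝ f) := hf.fderiv_right (by simp)
  exact h.clm_apply contDiff_const

lemma pdIter_smooth {d : ℕ} (j : Fin d) (n : ℕ) {f : Rd d → ℝ} (hf : ContDiff ℝ (⊤ : ℕ∞) f) :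
    ContDiff ℝ (⊤ : ℕ∞) (pdIter j n f) := by
  induction n with
  | zero => exact hf
  | succ n ih => exact pdR_smooth j ih

lemma foldr_smooth {d : ℕ} (α : Fin d → ℕ) (l : List (Fin d)) {f : Rd d → ℝ}
    (hf : ContDiff ℝ (⊤ : ℕ∞) f) :
    ContDiff ℝ (⊤ : ℕ∞) (l.foldr (fun j g => pdIter j (α j) g) f) := by
  induction l with
  | nil => exact hf
  | cons a l ih => exact pdIter_smooth a _ ih

lemma pdMulti_smooth {d : ℕ} (α : Fin d → ℕ) {f : Rd d → ℝ} (hf : ContDiff ℝ (⊤ : ℕ∞) f) :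
    ContDiff ℝ (⊤ : ℕ∞) (pdMulti α f) := foldr_smooth α _ hf

lemma pdR_comm {d : ℕ} (j k : Fin d) {f : Rd d → ℝ} (hf : ContDiff ℝ (⊤ : ℕ∞) f) :
    pdR j (pdR k f) = pdR k (pdR j f) := by
  funext x
  have h : ContDiff ℝ (⊤ : ℕ∞) (fderiv ℝ f) := hf.fderiv_right (by simp)
  have hd : DifferentiableAt ℝ (fderiv ℝ f) x := (h.differentiable (by simp)) x
  have key : ∀ a b : Fin d, pdR a (pdR b f) x
      = fderiv ℝ (fderiv ℝ f) x (EuclideanSpace.single a 1) (EuclideanSpace.single b 1) := by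
    intro a b
    unfold pdR
    rw [fderiv_clm_apply hd (differentiableAt_const _)]
    simp
  rw [key, key]
  have hs : IsSymmSndFDerivAt ℝ f x := by
    apply (hf.contDiffAt).isSymmSndFDerivAt
    simp only [minSmoothness_of_isRCLikeNormedField]
    exact WithTop.coe_le_coe.2 (le_top : (2 : ℕ∞) ≤ ⊤)
  exact hs _ _

lemma pdR_pdIter_comm {d : ℕ} (j k : Fin d) (n : ℕ) {f : Rd d → ℝ}
    (hf : ContDiff ℝ (⊤ : ℕ∞) f) :
    pdR j (pdIter k n f) = pdIter k n (pdR j f) := by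
  induction n with
  | zero => rfl
  | succ n ih =>
    change pdR j (pdR k (pdIter k n f)) = pdR k (pdIter k n (pdR j f))
    rw [pdR_comm j k (pdIter_smooth k n hf), ih]

lemma pdR_foldr {d : ℕ} (α : Fin d → ℕ) (j : Fin d) (l : List (Fin d)) (hl : l.Nodup)
    (hj : j ∈ l) {f : Rd d → ℝ} (hf : ContDiff ℝ (⊤ : ℕ∞) f) :
    pdR j (l.foldr (fun j g => pdIter j (α j) g) f)
      = l.foldr (fun k g => pdIter k ((α + Pi.single j 1 : Fin d → ℕ) k) g) f := by
  induction l with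
  | nil => simp at hj
  | cons a l ih =>
    rw [List.nodup_cons] at hl
    simp only [List.foldr_cons]
    by_cases h : j = a
    · subst h
      have hc : l.foldr (fun k g => pdIter k ((α + Pi.single j 1 : Fin d → ℕ) k) g) f
          = l.foldr (fun j g => pdIter j (α j) g) f := by
        apply List.foldr_ext
        intro b hb g
        have hbj : b ≠ j := fun e => hl.1 (e ▸ hb)
        simp [hbj]
      rw [hc]
      simp only [Pi.add_apply, Pi.single_eq_same]
      rfl
    · have hj' : j ∈ l := by
        rcases List.mem_cons.1 hj with h1 | h1
        · exact absurd h1 h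
        · exact h1
      rw [pdR_pdIter_comm j a _ (foldr_smooth α l hf), ih hl.2 hj']
      have : a ≠ j := fun e => h e.symm
      simp [this]

lemma pdR_pdMulti {d : ℕ} (α : Fin d → ℕ) (j : Fin d) {f : Rd d → ℝ}
    (hf : ContDiff ℝ (⊤ : ℕ∞) f) :
    pdR j (pdMulti α f) = pdMulti (α + Pi.single j 1) f :=
  pdR_foldr α j _ (List.nodup_finRange d) (List.mem_finRange j) hf

lemma mIdx_succ {d q : ℕ} {α : Fin d → ℕ} (h : α ∈ mIdx d q) (j : Fin d) :
    α + Pi.single j 1 ∈ mIdx d (q+1) := by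
  unfold mIdx at *
  rw [Finset.Nat.mem_antidiagonalTuple] at *
  simp [Finset.sum_add_distrib, h]

lemma pdMulti_zero {d : ℕ} (f : Rd d → ℝ) : pdMulti (0 : Fin d → ℕ) f = f := by
  unfold pdMulti
  induction List.finRange d with
  | nil => rfl
  | cons a l ih =>
    simp only [List.foldr_cons]
    rw [ih]
    rfl

lemma fderiv_bound {d : ℕ} (f : Rd d → ℝ) (z v : Rd d) (t : ℝ) (hv : ‖v‖ ≤ t) :
    |fderiv ℝ f z v| ≤ t * ∑ j, |pdR j f z| := by
  have hv' : v = ∑ j, v j • EuclideanSpace.single j (1:ℝ) := by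
    ext k
    simp [Pi.single_apply]
  conv_lhs => rw [hv']
  rw [map_sum, Finset.mul_sum]
  refine (Finset.abs_sum_le_sum_abs _ _).trans (Finset.sum_le_sum fun j _ => ?_)
  rw [map_smul, smul_eq_mul, abs_mul]
  have h1 : |v j| ≤ t := by
    have := PiLp.norm_apply_le v j
    rw [Real.norm_eq_abs] at this
    exact this.trans hv
  exact mul_le_mul_of_nonneg_right h1 (abs_nonneg _)

lemma gron {ι : Type*} (S : Finset ι) (g g' : ι → ℝ → ℝ) (K δ : ℝ) (hK : 0 < K) (hδ : 0 ≤ δ)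
    (hg : ∀ i ∈ S, ∀ s, HasDerivAt (g i) (g' i s) s)
    (hb : ∀ i ∈ S, ∀ s, |g' i s| ≤ K * (∑ k ∈ S, |g k s| + δ)) :
    ∑ i ∈ S, |g i 1| ≤ (S.card * Real.exp (K * (S.card + 1))) * (∑ i ∈ S, |g i 0| + δ) := by
  set M := K * ((S.card : ℝ) + 1) with hM
  have hMpos : 0 < M := by positivity
  let F : ℝ → (S → ℝ) := fun s i => g i s
  let F' : ℝ → (S → ℝ) := fun s i => g' i s
  have hF : ∀ s, HasDerivAt F (F' s) s := fun s =>
    hasDerivAt_pi.2 fun i => hg i i.2 s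
  have hsum : ∀ s, ∑ k ∈ S, |g k s| ≤ S.card * ‖F s‖ := by
    intro s
    rw [← nsmul_eq_mul]
    apply Finset.sum_le_card_nsmul
    intro i hi
    exact norm_le_pi_norm (F s) ⟨i, hi⟩
  have h0 : ‖F 0‖ ≤ ∑ i ∈ S, |g i 0| := by
    rw [pi_norm_le_iff_of_nonneg (Finset.sum_nonneg fun _ _ => abs_nonneg _)]
    intro i
    exact Finset.single_le_sum (f := fun i => |g i 0|) (fun _ _ => abs_nonneg _) i.2
  have hbd : ∀ s ∈ Set.Ico (0:ℝ) 1, ‖F' s‖ ≤ M * ‖F s‖ + M * δ := by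
    intro s _
    have hn : 0 ≤ ‖F s‖ := norm_nonneg _
    rw [pi_norm_le_iff_of_nonneg (by positivity)]
    intro i
    refine (hb i i.2 s).trans ?_
    rw [← mul_add, hM, mul_assoc]
    apply mul_le_mul_of_nonneg_left _ hK.le
    have := hsum s
    have hc : (0:ℝ) ≤ S.card := by positivity
    nlinarith [mul_nonneg hc hδ]
  have := norm_le_gronwallBound_of_norm_deriv_right_le (f := F) (f' := F') (a := 0) (b := 1)
    (fun s _ => (hF s).continuousAt.continuousWithinAt)
    (fun s _ => (hF s).hasDerivWithinAt) h0 hbd 1 (by simp)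
  rw [gronwallBound_of_K_ne_0 hMpos.ne'] at this
  have e : M * δ / M = δ := by field_simp
  simp only [e, sub_zero, mul_one] at this
  refine (hsum 1).trans ?_
  rw [mul_assoc]
  apply mul_le_mul_of_nonneg_left _ (by positivity)
  nlinarith

/-- Labels for the functions `U_ℓ`, `B_{jk}`, `V`. -/
abbrev Lab (d p : ℕ) := Fin p ⊕ ((Fin d × Fin d) ⊕ Unit)

def labFun {d p : ℕ} (A : Fin d → Rd d → ℝ) (U : Fin p → Rd d → ℝ) (V : Rd d → ℝ) :
    Lab d p → Rd d → ℝ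
  | Sum.inl l => U l
  | Sum.inr (Sum.inl jk) => magB A jk.1 jk.2
  | Sum.inr (Sum.inr _) => V

def labOff {d p : ℕ} : Lab d p → ℕ
  | Sum.inl _ => 0
  | Sum.inr _ => 1

def labSet (d p : ℕ) : Finset (Lab d p) :=
  Finset.univ.disjSum
    ((Finset.univ.filter (fun jk : Fin d × Fin d => jk.1 < jk.2)).disjSum Finset.univ)

def idxSet (d p r : ℕ) : Finset (Σ _ : Lab d p, Σ _ : ℕ, (Fin d → ℕ)) :=
  (labSet d p).sigma fun l => (Finset.range (r + 1 - labOff l)).sigma fun q => mIdx d q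

lemma Phi_eq_idx {d p : ℕ} (A : Fin d → Rd d → ℝ) (U : Fin p → Rd d → ℝ) (V : Rd d → ℝ)
    (r : ℕ) (x : Rd d) (t : ℝ) (ht : 0 ≤ t) :
    ∑ i ∈ idxSet d p r, |t^(i.2.1 + labOff i.1 + 1) * pdMulti i.2.2 (labFun A U V i.1) x|
      = Phi A U V r x t := by
  have h : ∀ n : ℕ, |t| ^ n = t ^ n := fun n => by rw [abs_of_nonneg ht]
  unfold idxSet labSet Phi
  rw [Finset.sum_sigma]
  simp only [Finset.sum_sigma, Finset.sum_disjSum, abs_mul, abs_pow, h, labOff, labFun,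
    ← Finset.mul_sum]
  simp [add_assoc]

lemma mq_nonneg {d p : ℕ} (A : Fin d → Rd d → ℝ) (U : Fin p → Rd d → ℝ) (V : Rd d → ℝ)
    (q : ℕ) (x : Rd d) : 0 ≤ mq A U V q x := by
  cases q <;> unfold mq <;> positivity

lemma mIdx_zero (d : ℕ) : mIdx d 0 = {0} := by
  ext α
  unfold mIdx
  rw [Finset.Nat.mem_antidiagonalTuple, Finset.mem_singleton, Finset.sum_eq_zero_iff, funext_iff]
  simp

lemma Phi_eq_mq {d p : ℕ} (A : Fin d → Rd d → ℝ) (U : Fin p → Rd d → ℝ) (V : Rd d → ℝ)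
    (r : ℕ) (x : Rd d) (t : ℝ) :
    Phi A U V r x t = ∑ q ∈ Finset.range (r+1), t^(q+1) * mq A U V q x := by
  rw [Finset.sum_range_succ']
  unfold Phi mq
  simp only [Finset.sum_range_succ', mIdx_zero, Finset.sum_singleton, pdMulti_zero, mul_add,
    Finset.sum_add_distrib, Finset.mul_sum]
  have e1 : ∀ G : Fin p → ℕ → ℝ, ∑ l, ∑ q ∈ Finset.range r, G l q
      = ∑ q ∈ Finset.range r, ∑ l, G l q := fun G => Finset.sum_comm
  have e2 : ∀ G : Fin d × Fin d → ℕ → ℝ,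
      ∑ l ∈ Finset.univ.filter (fun jk : Fin d × Fin d => jk.1 < jk.2),
        ∑ q ∈ Finset.range r, G l q
      = ∑ q ∈ Finset.range r,
        ∑ l ∈ Finset.univ.filter (fun jk : Fin d × Fin d => jk.1 < jk.2), G l q :=
    fun G => Finset.sum_comm
  rw [e1, e2]
  ring

lemma lab_le_mq {d p : ℕ} (A : Fin d → Rd d → ℝ) (U : Fin p → Rd d → ℝ) (V : Rd d → ℝ)
    (l : Lab d p) (hl : l ∈ labSet d p) (q : ℕ) (x : Rd d) :
    ∑ α ∈ mIdx d (q+1), |pdMulti α (labFun A U V l) x| ≤ mq A U V (q + labOff l + 1) x := by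
  have n1 : ∀ q, 0 ≤ ∑ l, ∑ α ∈ mIdx d q, |pdMulti α (U l) x| := fun q => by positivity
  have n2 : ∀ q, 0 ≤ ∑ jk ∈ Finset.univ.filter (fun jk : Fin d × Fin d => jk.1 < jk.2),
      ∑ α ∈ mIdx d q, |pdMulti α (magB A jk.1 jk.2) x| := fun q => by positivity
  have n3 : ∀ q, 0 ≤ ∑ α ∈ mIdx d q, |pdMulti α V x| := fun q => by positivity
  rcases l with l | jk | u
  · simp only [labFun, labOff, mq, add_zero]
    have := Finset.single_le_sum (f := fun l => ∑ α ∈ mIdx d (q+1), |pdMulti α (U l) x|)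
      (fun _ _ => by positivity) (Finset.mem_univ l)
    have := n2 q
    have := n3 q
    linarith
  · simp only [labFun, labOff, mq]
    have hm : jk ∈ Finset.univ.filter (fun jk : Fin d × Fin d => jk.1 < jk.2) := by
      simpa [labSet] using hl
    have := Finset.single_le_sum
      (f := fun jk : Fin d × Fin d => ∑ α ∈ mIdx d (q+1), |pdMulti α (magB A jk.1 jk.2) x|)
      (fun _ _ => by positivity) hm
    have := n1 (q+1+1)
    have := n3 (q+1)
    linarith
  · simp only [labFun, labOff, mq]
    have := n1 (q+1+1)
    have := n2 (q+1)
    linarith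

lemma labFun_smooth {d p : ℕ} {A : Fin d → Rd d → ℝ} {U : Fin p → Rd d → ℝ} {V : Rd d → ℝ}
    (hA : ∀ j, ContDiff ℝ (⊤ : ℕ∞) (A j)) (hU : ∀ ℓ, ContDiff ℝ (⊤ : ℕ∞) (U ℓ))
    (hV : ContDiff ℝ (⊤ : ℕ∞) V) (l : Lab d p) : ContDiff ℝ (⊤ : ℕ∞) (labFun A U V l) := by
  rcases l with l | jk | u
  · exact hU l
  · exact (pdR_smooth _ (hA _)).sub (pdR_smooth _ (hA _))
  · exact hV

lemma mq_step {d p r : ℕ} {A : Fin d → Rd d → ℝ} {U : Fin p → Rd d → ℝ} {V : Rd d → ℝ}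
    {C₀ : ℝ} (hC₀ : 0 < C₀) (hT : ∀ x, mq A U V (r+1) x ≤ C₀ * mr A U V r x)
    {t : ℝ} (ht : 0 < t) (ht1 : t < 1) (z : Rd d) (n : ℕ) (hn : n ≤ r) :
    t^(n+2) * mq A U V (n+1) z ≤ (1 + C₀) * (Phi A U V r z t + t^(r+1)) := by
  have hP : 0 ≤ Phi A U V r z t := by
    rw [Phi_eq_mq]
    exact Finset.sum_nonneg fun q _ => mul_nonneg (by positivity) (mq_nonneg _ _ _ _ _)
  have htr : 0 < t^(r+1) := by positivity
  rcases hn.lt_or_eq with h | h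
  · have : t^(n+1+1) * mq A U V (n+1) z ≤ Phi A U V r z t := by
      rw [Phi_eq_mq]
      exact Finset.single_le_sum (f := fun q => t^(q+1) * mq A U V q z)
        (fun q _ => mul_nonneg (by positivity) (mq_nonneg _ _ _ _ _))
        (Finset.mem_range.2 (by omega))
    have h2 : t^(n+2) * mq A U V (n+1) z ≤ Phi A U V r z t := this
    nlinarith
  · subst h
    have h1 : t^(n+1) * mr A U V n z ≤ Phi A U V n z t + t^(n+1) := by
      unfold mr
      rw [mul_add, mul_one, Phi_eq_mq, Finset.mul_sum, add_comm]
      refine add_le_add (Finset.sum_le_sum fun q hq => ?_) le_rfl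
      refine mul_le_mul_of_nonneg_right ?_ (mq_nonneg _ _ _ _ _)
      · exact pow_le_pow_of_le_one ht.le ht1.le (by have := Finset.mem_range.1 hq; omega)
    have h2 : t^(n+2) * mq A U V (n+1) z ≤ t^(n+1) * mq A U V (n+1) z := by
      gcongr ?_ * _
      · exact mq_nonneg _ _ _ _ _
      · exact pow_le_pow_of_le_one ht.le ht1.le (by omega)
    have h3 : t^(n+1) * mq A U V (n+1) z ≤ t^(n+1) * (C₀ * mr A U V n z) := by
      gcongr
      exact hT z
    nlinarith

/-- `Φ(y,t) ≤ C₂ Φ(x,t) + C₂ t^{r+1}` when `|y - x| ≤ t`. -/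
theorem statement_10 (d p r : ℕ) (hd : 1 ≤ d) (hr : 1 ≤ r)
    (A : Fin d → Rd d → ℝ) (U : Fin p → Rd d → ℝ) (V : Rd d → ℝ)
    (hA : ∀ j, ContDiff ℝ (⊤ : ℕ∞) (A j)) (hU : ∀ ℓ, ContDiff ℝ (⊤ : ℕ∞) (U ℓ)) (hV : ContDiff ℝ (⊤ : ℕ∞) V)
    (C₀ : ℝ) (hC₀ : 0 < C₀)
    (hT : ∀ x, mq A U V (r+1) x ≤ C₀ * mr A U V r x) :
    ∃ C₂ : ℝ, 1 < C₂ ∧ ∀ t ∈ Set.Ioo (0:ℝ) 1, ∀ x y : Rd d, dist y x ≤ t →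
      Phi A U V r y t ≤ C₂ * Phi A U V r x t + C₂ * t^(r+1) := by
  classical
  have hd' : (0:ℝ) < d := by exact_mod_cast hd
  set S := idxSet d p r with hS
  set K : ℝ := d * (1 + C₀) with hK
  have hKpos : 0 < K := by positivity
  set C : ℝ := S.card * Real.exp (K * (S.card + 1)) with hC
  have hCn : 0 ≤ C := by positivity
  refine ⟨C + 2, by linarith, ?_⟩
  intro t ht x y hxy
  obtain ⟨ht0, ht1⟩ := ht
  have hv : ‖y - x‖ ≤ t := by rwa [← dist_eq_norm]
  have htr : 0 < t^(r+1) := by positivity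
  have hsm := labFun_smooth hA hU hV
  let f : (Σ _ : Lab d p, Σ _ : ℕ, (Fin d → ℕ)) → Rd d → ℝ :=
    fun i => pdMulti i.2.2 (labFun A U V i.1)
  have hf : ∀ i, ContDiff ℝ (⊤ : ℕ∞) (f i) := fun i => pdMulti_smooth _ (hsm _)
  have main := gron S
    (fun i s => t^(i.2.1 + labOff i.1 + 1) * f i (x + s • (y - x)))
    (fun i s => t^(i.2.1 + labOff i.1 + 1) * fderiv ℝ (f i) (x + s • (y - x)) (y - x))
    K (t^(r+1)) hKpos htr.le ?_ ?_
  · have e : ∀ s : ℝ, ∑ i ∈ S, |t^(i.2.1 + labOff i.1 + 1) * f i (x + s • (y - x))|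
        = Phi A U V r (x + s • (y - x)) t := fun s => Phi_eq_idx A U V r _ t ht0.le
    simp only [e] at main
    have e1 : x + (1:ℝ) • (y - x) = y := by simp
    have e0 : x + (0:ℝ) • (y - x) = x := by simp
    rw [e1, e0] at main
    have hP : 0 ≤ Phi A U V r x t := by
      rw [Phi_eq_mq]
      exact Finset.sum_nonneg fun q _ => mul_nonneg (by positivity) (mq_nonneg _ _ _ _ _)
    nlinarith
  · intro i _ s
    have h1 : HasDerivAt (fun s : ℝ => x + s • (y - x)) (y - x) s := by
      simpa using ((hasDerivAt_id s).smul_const (y - x)).const_add x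
    have h2 := ((hf i).differentiable (by simp) (x + s • (y - x))).hasFDerivAt
    exact (h2.comp_hasDerivAt s h1).const_mul _
  · intro i hi s
    have e : ∑ i ∈ S, |t^(i.2.1 + labOff i.1 + 1) * f i (x + s • (y - x))|
        = Phi A U V r (x + s • (y - x)) t := Phi_eq_idx A U V r _ t ht0.le
    simp only [e]
    generalize x + s • (y - x) = z
    obtain ⟨l, q, α⟩ := i
    simp only [hS, idxSet, Finset.mem_sigma, Finset.mem_range] at hi
    obtain ⟨hl, hq, hα⟩ := hi
    rw [abs_mul, abs_of_nonneg (by positivity : (0:ℝ) ≤ t^(q + labOff l + 1))]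
    have b1 := fderiv_bound (f ⟨l, q, α⟩) z (y - x) t hv
    have b2 : ∑ j, |pdR j (f ⟨l, q, α⟩) z| ≤ d * mq A U V (q + labOff l + 1) z := by
      have : ∀ j ∈ (Finset.univ : Finset (Fin d)),
          |pdR j (f ⟨l, q, α⟩) z| ≤ mq A U V (q + labOff l + 1) z := by
        intro j _
        refine le_trans ?_ (lab_le_mq A U V l hl q z)
        change |pdR j (pdMulti α (labFun A U V l)) z| ≤ _
        rw [pdR_pdMulti α j (hsm l)]
        exact Finset.single_le_sum (f := fun β => |pdMulti β (labFun A U V l) z|)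
          (fun _ _ => abs_nonneg _) (mIdx_succ hα j)
      simpa using Finset.sum_le_card_nsmul _ _ _ this
    have b3 := mq_step hC₀ hT ht0 ht1 z (q + labOff l) (by omega)
    calc t^(q + labOff l + 1) * |fderiv ℝ (f ⟨l, q, α⟩) z (y - x)|
        ≤ t^(q + labOff l + 1) * (t * (d * mq A U V (q + labOff l + 1) z)) := by
          gcongr
          exact b1.trans (by gcongr)
      _ = d * (t^(q + labOff l + 2) * mq A U V (q + labOff l + 1) z) := by ring
      _ ≤ d * ((1 + C₀) * (Phi A U V r z t + t^(r+1))) := by gcongr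
      _ = K * (Phi A U V r z t + t^(r+1)) := by rw [hK]; ring

end
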